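/- arXiv:2511.14340 — 5 statements merged into one kernel-verified Lean document; each statement's English description precedes it below -/
import Mathlib

section
/- Let n ≥ 2, let φ : Mₙ(ℂ) → ℂ be a linear functional, and let A ∈ Mₙ(ℂ) be any matrix. Then there exists a unitary matrix U ∈ Mₙ(ℂ) such that φ(UA) = 0. -/
open scoped Matrix

/-- A linear functional on square matrices is the trace against a fixed matrix. -/
theorem Matrix.exists_functional_eq_trace_mul {R m : Type*} [CommSemiring R] [Fintype m]
    [DecidableEq m] (φ : Matrix m m R →ₗ[R] R) :
    ∃ M : Matrix m m R, ∀ X, φ X = (X * M).trace := by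
  refine ⟨Matrix.of fun j i => φ (Matrix.single i j 1), fun X => ?_⟩
  conv_lhs => rw [Matrix.matrix_eq_sum_single X]
  simp only [map_sum, Matrix.trace, Matrix.diag_apply, Matrix.mul_apply, Matrix.of_apply]
  refine Finset.sum_congr rfl fun i _ => Finset.sum_congr rfl fun j _ => ?_
  rw [← smul_eq_mul, ← map_smul, Matrix.smul_single, smul_eq_mul, mul_one]

/-- If the columns of `C` are pairwise orthogonal, then `C` can be rotated by a unitary
so that its diagonal vanishes. -/
theorem Matrix.exists_unitary_diag_mul_eq_zero {m : Type*} [Fintype m] [DecidableEq m]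
    (σ : Equiv.Perm m) (hσ : ∀ i, σ i ≠ i) (C : Matrix m m ℂ) (hC : (Cᴴ * C).IsDiag) :
    ∃ V ∈ unitary (Matrix m m ℂ), ∀ i, (V * C) i i = 0 := by
  let c : m → EuclideanSpace ℂ m := fun j => WithLp.toLp 2 fun k => C k j
  have inner_c : ∀ i j, i ≠ j → inner ℂ (c i) (c j) = 0 := fun i j hij => by
    have h := hC hij
    simpa [c, PiLp.inner_apply, Matrix.mul_apply, mul_comm] using h
  let v : m → EuclideanSpace ℂ m := fun j => ((‖c j‖ : ℂ)⁻¹) • c j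
  have hv : Orthonormal ℂ ({j | c j ≠ 0}.domRestrict v) := by
    constructor
    · rintro ⟨j, hj⟩
      have : ‖c j‖ ≠ 0 := norm_ne_zero_iff.mpr hj
      change ‖v j‖ = 1
      simp [v, norm_smul, this]
    · rintro ⟨i, hi⟩ ⟨j, hj⟩ hij
      have : i ≠ j := fun h => hij (Subtype.ext h)
      change inner ℂ (v i) (v j) = 0
      simp [v, inner_c i j this]
  obtain ⟨b, hb⟩ := hv.exists_orthonormalBasis_extension_of_card_eq (by simp)
  have inner_b : ∀ i j, i ≠ j → inner ℂ (b i) (c j) = 0 := fun i j hij => by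
    by_cases hj : c j = 0
    · simp [hj]
    · have hn : (‖c j‖ : ℂ) ≠ 0 := by simpa using hj
      have hcj : c j = (‖c j‖ : ℂ) • b j := by
        rw [hb j hj, smul_smul, mul_inv_cancel₀ hn, one_smul]
      rw [hcj, inner_smul_right, b.inner_eq_zero hij, mul_zero]
  refine ⟨Matrix.of fun i k => star (b (σ i) k), ?_, fun i => ?_⟩
  · rw [← Matrix.unitaryGroup, Matrix.mem_unitaryGroup_iff]
    ext i j
    have h := b.inner_eq_ite (σ i) (σ j)
    simpa [PiLp.inner_apply, Matrix.mul_apply, Matrix.star_apply, Matrix.one_apply, mul_comm]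
      using h
  · have h := inner_b (σ i) i (hσ i)
    simpa [c, PiLp.inner_apply, Matrix.mul_apply, mul_comm] using h

/-- For any linear functional `φ` on `Mₙ(ℂ)` (`n ≥ 2`) and any matrix `A`,
there is a unitary `U` with `φ(UA) = 0`. -/
theorem exists_unitary_functional_mul_eq_zero
    (n : ℕ) (hn : 2 ≤ n) (φ : Matrix (Fin n) (Fin n) ℂ →ₗ[ℂ] ℂ)
    (A : Matrix (Fin n) (Fin n) ℂ) :
    ∃ U ∈ unitary (Matrix (Fin n) (Fin n) ℂ), φ (U * A) = 0 := by
  obtain ⟨M, hM⟩ := Matrix.exists_functional_eq_trace_mul φ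
  have hB := Matrix.isHermitian_conjTranspose_mul_self (A * M)
  let W := hB.eigenvectorUnitary
  have hW : ((A * M * W.1)ᴴ * (A * M * W.1)).IsDiag := by
    have h := hB.conjStarAlgAut_star_eigenvectorUnitary
    rw [Unitary.conjStarAlgAut_star_apply] at h
    have h' : (A * M * W.1)ᴴ * (A * M * W.1) = star W.1 * ((A * M)ᴴ * (A * M)) * W.1 := by
      rw [Matrix.conjTranspose_mul (A * M), Matrix.star_eq_conjTranspose]
      simp only [Matrix.mul_assoc]
    rw [h', h]
    exact Matrix.isDiag_diagonal _
  have hσ : ∀ i : Fin n, finRotate n i ≠ i := by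
    obtain ⟨m, rfl⟩ := Nat.exists_eq_add_of_le' hn
    intro i
    rw [finRotate_apply]
    simp
  obtain ⟨V, hV, hdiag⟩ := Matrix.exists_unitary_diag_mul_eq_zero _ hσ _ hW
  refine ⟨W.1 * V, mul_mem W.2 hV, ?_⟩
  rw [hM, Matrix.mul_assoc (W.1 * V), Matrix.mul_assoc, Matrix.trace_mul_comm, Matrix.mul_assoc]
  exact Finset.sum_eq_zero fun i _ => hdiag i
end

section
/- For every n ≥ 1, the set S = {U ∈ Mₙ(ℂ) : U unitary and U has at most 2 distinct eigenvalues} is path-connected (in the topology induced by any norm on Mₙ(ℂ)). -/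
/-- A family of functions acting on a normal matrix through the functional calculus is continuous
as soon as it is pointwise continuous, because the spectrum is finite. -/
theorem Matrix.continuous_cfc_fun {X : Type*} [TopologicalSpace X] {m : Type*} [Fintype m]
    [DecidableEq m] (U : Matrix m m ℂ) (f : X → ℂ → ℂ)
    (hf : ∀ z ∈ spectrum ℂ U, Continuous fun x ↦ f x z) :
    open scoped Matrix.Norms.L2Operator in
    Continuous fun x ↦ cfc (p := IsStarNormal) (f x) U := by
  open scoped Matrix.Norms.L2Operator in
  have hfin := U.finite_spectrum
  refine continuous_iff_continuousAt.2 fun x₀ ↦ continuousAt_cfc_fun ?_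
    (.of_forall fun x ↦ hfin.continuousOn _)
  refine Metric.tendstoUniformlyOn_iff.2 fun ε hε ↦ ?_
  refine (hfin.eventually_all).2 fun z hz ↦ ?_
  have := (hf z hz).tendsto x₀
  simpa only [dist_comm] using! Metric.tendsto_nhds.1 this ε hε

/-- For every `n ≥ 1`, the set of unitary matrices in `Mₙ(ℂ)` with at most 2
distinct eigenvalues is path-connected. -/
theorem isPathConnected_unitary_two_eigenvalues (n : ℕ) (hn : 1 ≤ n) :
    IsPathConnected {U : Matrix (Fin n) (Fin n) ℂ |
      U ∈ unitary (Matrix (Fin n) (Fin n) ℂ) ∧ (spectrum ℂ U).ncard ≤ 2} := by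
  open scoped Matrix.Norms.L2Operator in
  have : Nonempty (Fin n) := ⟨⟨0, hn⟩⟩
  refine ⟨1, ⟨one_mem _, by simp⟩, ?_⟩
  rintro U ⟨hU, hcard⟩
  have hfin := U.finite_spectrum
  have hnormal : IsStarNormal U := ⟨by rw [Commute, SemiconjBy, hU.1, hU.2]⟩
  let f : unitInterval → ℂ → ℂ := fun t z ↦ Complex.exp ((t * z.arg : ℝ) * Complex.I)
  have hcont (t : unitInterval) : ContinuousOn (f t) (spectrum ℂ U) := hfin.continuousOn _
  refine ⟨⟨⟨fun t ↦ cfc (f t) U, ?_⟩, ?_, ?_⟩, fun t ↦ ⟨?_, ?_⟩⟩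
  · exact U.continuous_cfc_fun f fun z _ ↦ by fun_prop
  · simp [f, cfc_const_one ℂ U]
  · refine (cfc_congr fun z hz ↦ ?_).trans (cfc_id ℂ U)
    have hz1 : ‖z‖ = 1 := spectrum.norm_eq_one_of_unitary hU hz
    simpa [f, hz1] using Complex.norm_mul_exp_arg_mul_I z
  · refine (cfc_unitary_iff (f t) U hnormal (hcont t)).2 fun z _ ↦ ?_
    rw [Complex.star_def, Complex.conj_mul', Complex.norm_exp_ofReal_mul_I]
    simp
  · change (spectrum ℂ (cfc (f t) U)).ncard ≤ 2
    rw [cfc_map_spectrum (f t) U hnormal (hcont t)]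
    exact (Set.ncard_image_le hfin).trans hcard
end

section
/- Let H be an infinite-dimensional complex Hilbert space and let φ : B(H) → ℂ be a state, i.e., a linear functional with φ(I) = 1 and φ(A) ≥ 0 for every positive operator A. Then there exists an orthogonal projection P on H such that P is unitarily equivalent to I − P (i.e., I − P = V P V* for some unitary V) and φ(P) = 1/2. -/
open ComplexOrder

/-- A family of unimodular scalars and a permutation of a Hilbert basis define a unitary. -/
theorem HilbertBasis.exists_weighted_permutation {H ι : Type*} [NormedAddCommGroup H]
    [InnerProductSpace ℂ H] [CompleteSpace H] (b : HilbertBasis ι ℂ H)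
    (s : ι → ℂ) (hs : ∀ i, ‖s i‖ = 1) (σ : Equiv.Perm ι) :
    ∃ U : H ≃ₗᵢ[ℂ] H, ∀ i, U (b i) = s i • b (σ i) := by
  have hs0 (i : ι) : s i ≠ 0 := norm_ne_zero_iff.mp (by simp [hs i])
  have hv : Orthonormal ℂ (fun i => s i • b (σ i)) := by
    refine ⟨fun i => by simp [norm_smul, hs, b.orthonormal.1], fun i j hij => ?_⟩
    simp [inner_smul_left, inner_smul_right,
      b.orthonormal.2 (fun h => hij (σ.injective h) : σ i ≠ σ j)]
  have hspan : ⊤ ≤ (Submodule.span ℂ (Set.range fun i => s i • b (σ i))).topologicalClosure := by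
    rw [← b.dense_span]
    refine Submodule.topologicalClosure_mono (Submodule.span_le.mpr ?_)
    rintro _ ⟨i, rfl⟩
    have h := Submodule.smul_mem _ (s (σ.symm i))⁻¹
      (Submodule.subset_span (R := ℂ) (Set.mem_range_self (f := fun i => s i • b (σ i)) (σ.symm i)))
    simpa [smul_smul, hs0] using h
  refine ⟨b.repr.trans (HilbertBasis.mk hv hspan).repr.symm, fun i => ?_⟩
  classical
  have h : (HilbertBasis.mk hv hspan) i = s i • b (σ i) := by simp
  rw [← h, LinearIsometryEquiv.trans_apply, b.repr_self, HilbertBasis.repr_symm_single]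

/-- Continuous linear maps agreeing on a Hilbert basis are equal. -/
theorem HilbertBasis.continuousLinearMap_ext {H ι : Type*} [NormedAddCommGroup H]
    [InnerProductSpace ℂ H] (b : HilbertBasis ι ℂ H)
    {S T : H →L[ℂ] H} (h : ∀ i, S (b i) = T (b i)) : S = T := by
  refine ContinuousLinearMap.ext_on (s := Set.range b)
    ((Submodule.dense_iff_topologicalClosure_eq_top).mpr b.dense_span) ?_
  rintro _ ⟨i, rfl⟩
  exact h i

/-- An isometric involution is self-adjoint. -/
theorem LinearIsometryEquiv.star_eq_self_of_mul_self {H : Type*} [NormedAddCommGroup H]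
    [InnerProductSpace ℂ H] [CompleteSpace H] (U : H ≃ₗᵢ[ℂ] H)
    (h : (U : H →L[ℂ] H) * (U : H →L[ℂ] H) = 1) :
    star (U : H →L[ℂ] H) = (U : H →L[ℂ] H) := by
  have hadj : star (U : H →L[ℂ] H) * (U : H →L[ℂ] H) = 1 := by
    ext x
    refine ext_inner_left ℂ fun y => ?_
    simp [ContinuousLinearMap.star_eq_adjoint]
  exact left_inv_eq_right_inv hadj h

/-- On an infinite-dimensional Hilbert space there are two anticommuting symmetries. -/
theorem exists_anticommuting_symmetries {H : Type*} [NormedAddCommGroup H]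
    [InnerProductSpace ℂ H] [CompleteSpace H] (hinf : ¬ FiniteDimensional ℂ H) :
    ∃ A B : H →L[ℂ] H, star A = A ∧ star B = B ∧ A * A = 1 ∧ B * B = 1 ∧
      B * A = -(A * B) := by
  obtain ⟨w, b, -⟩ := exists_hilbertBasis ℂ H
  have hw : Infinite w := by
    by_contra hfin
    rw [not_infinite_iff_finite] at hfin
    have := Fintype.ofFinite w
    exact hinf b.toOrthonormalBasis.toBasis.finiteDimensional_of_finite
  obtain ⟨e⟩ : Nonempty (w ⊕ w ≃ w) := by
    rw [← Cardinal.eq, Cardinal.mk_sum, Cardinal.lift_id]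
    exact Cardinal.add_eq_self (Cardinal.aleph0_le_mk w)
  let s : w → ℂ := fun i => Sum.elim (fun _ => 1) (fun _ => -1) (e.symm i)
  let σ : Equiv.Perm w := (e.symm.trans (Equiv.sumComm w w)).trans e
  have hs2 (i : w) : s i * s i = 1 := by
    rcases h : e.symm i <;> simp [s, h]
  have hsn (i : w) : ‖s i‖ = 1 := by
    rcases h : e.symm i <;> simp [s, h]
  have hσ2 (i : w) : σ (σ i) = i := by simp [σ]
  have hsσ (i : w) : s (σ i) = -s i := by
    rcases h : e.symm i <;> simp [s, σ, h]
  obtain ⟨A, hA⟩ := b.exists_weighted_permutation s hsn (Equiv.refl w)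
  obtain ⟨B, hB⟩ := b.exists_weighted_permutation (fun _ => 1) (by simp) σ
  simp only [Equiv.refl_apply, one_smul] at hA hB
  have hAA : (A : H →L[ℂ] H) * (A : H →L[ℂ] H) = 1 :=
    b.continuousLinearMap_ext fun i => by simp [hA, smul_smul, hs2]
  have hBB : (B : H →L[ℂ] H) * (B : H →L[ℂ] H) = 1 :=
    b.continuousLinearMap_ext fun i => by simp [hB, hσ2]
  exact ⟨A, B, A.star_eq_self_of_mul_self hAA, B.star_eq_self_of_mul_self hBB, hAA, hBB,
    b.continuousLinearMap_ext fun i => by simp [hA, hB, hsσ]⟩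

/-- A positive functional takes real values at symmetries. -/
theorem exists_real_apply_eq_of_symmetry {H : Type*} [NormedAddCommGroup H]
    [InnerProductSpace ℂ H] [CompleteSpace H]
    (φ : (H →L[ℂ] H) →ₗ[ℂ] ℂ) (hφ1 : φ 1 = 1)
    (hφpos : ∀ A : H →L[ℂ] H, A.IsPositive → 0 ≤ φ A)
    {A : H →L[ℂ] H} (hA : star A = A) (hAA : A * A = 1) : ∃ a : ℝ, φ A = a := by
  have hpos : (star (1 + A) * (1 + A)).IsPositive :=
    (ContinuousLinearMap.nonneg_iff_isPositive _).mp (star_mul_self_nonneg _)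
  have heq : star (1 + A) * (1 + A) = (2 : ℂ) • (1 + A) := by
    rw [star_add, star_one, hA, two_smul, mul_add, add_mul, add_mul, hAA]
    simp only [one_mul, mul_one]
    abel
  have h := hφpos _ hpos
  rw [heq, map_smul, map_add, hφ1, Complex.nonneg_iff] at h
  refine ⟨(φ A).re, Complex.ext rfl ?_⟩
  have := h.2
  simp at this
  simpa using this

/-- Every linear form on the real plane vanishes at some point of the unit circle. -/
theorem exists_unit_mul_add_mul_eq_zero (a b : ℝ) :
    ∃ c s : ℝ, c * c + s * s = 1 ∧ c * a + s * b = 0 := by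
  by_cases h : a = 0
  · exact ⟨1, 0, by simp [h]⟩
  have hpos : 0 < a ^ 2 + b ^ 2 := by positivity
  have hr : Real.sqrt (a ^ 2 + b ^ 2) ≠ 0 := (Real.sqrt_pos.mpr hpos).ne'
  refine ⟨b / Real.sqrt (a ^ 2 + b ^ 2), -a / Real.sqrt (a ^ 2 + b ^ 2), ?_, ?_⟩
  · field_simp
    rw [Real.sq_sqrt hpos.le]
    ring
  · ring

/-- For any state `φ` on `B(H)`, `H` an infinite-dimensional complex Hilbert
space, there is an orthogonal projection `P`, unitarily equivalent to `I - P`,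
with `φ(P) = 1/2`. -/
theorem exists_projection_half
    {H : Type*} [NormedAddCommGroup H] [InnerProductSpace ℂ H] [CompleteSpace H]
    (hinf : ¬ FiniteDimensional ℂ H)
    (φ : (H →L[ℂ] H) →ₗ[ℂ] ℂ) (hφ1 : φ 1 = 1)
    (hφpos : ∀ A : H →L[ℂ] H, A.IsPositive → 0 ≤ φ A) :
    ∃ P : H →L[ℂ] H, star P = P ∧ P * P = P ∧
      (∃ V ∈ unitary (H →L[ℂ] H), 1 - P = V * P * star V) ∧
      φ P = (1 / 2 : ℂ) := by
  obtain ⟨A, B, hA, hB, hAA, hBB, hBA⟩ := exists_anticommuting_symmetries hinf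
  obtain ⟨a, ha⟩ := exists_real_apply_eq_of_symmetry φ hφ1 hφpos hA hAA
  obtain ⟨b, hb⟩ := exists_real_apply_eq_of_symmetry φ hφ1 hφpos hB hBB
  obtain ⟨c, s, hcs, hab⟩ := exists_unit_mul_add_mul_eq_zero a b
  set T : H →L[ℂ] H := (c : ℂ) • A + (s : ℂ) • B with hT
  have hTstar : star T = T := by simp [hT, hA, hB]
  have hTT : T * T = 1 := by
    have : T * T = ((c : ℂ) * c + s * s) • (1 : H →L[ℂ] H) := by
      simp only [hT, mul_add, add_mul, smul_mul_smul_comm, hAA, hBB, hBA]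
      module
    rw [this, ← Complex.ofReal_mul, ← Complex.ofReal_mul, ← Complex.ofReal_add, hcs]
    simp
  have hVstar : star (A * B) = B * A := by rw [star_mul, hA, hB]
  have hVV : A * B * (B * A) = 1 := by
    rw [mul_assoc, ← mul_assoc B, hBB, one_mul, hAA]
  have hVV' : B * A * (A * B) = 1 := by
    rw [mul_assoc, ← mul_assoc A, hAA, one_mul, hBB]
  have hVA : A * B * A * (B * A) = -A := by
    rw [mul_assoc A B A, hBA, mul_neg, mul_neg, ← mul_assoc A A B, hAA, one_mul, neg_mul, neg_neg,
      ← mul_assoc, hBA, neg_mul, mul_assoc, hBB, mul_one]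
  have hVB : A * B * B * (B * A) = -B := by
    rw [mul_assoc A B B, hBB, mul_one, hBA, mul_neg, ← mul_assoc, hAA, one_mul]
  have hVT : A * B * T * (B * A) = -T := by
    simp only [hT, mul_add, add_mul, mul_smul_comm, smul_mul_assoc, hVA, hVB]
    module
  have hφT : φ T = 0 := by
    rw [hT, map_add, map_smul, map_smul, ha, hb]
    simp only [smul_eq_mul]
    exact_mod_cast hab
  refine ⟨(1 / 2 : ℂ) • (1 + T), ?_, ?_, ⟨A * B, ?_, ?_⟩, ?_⟩
  · simp [hTstar]
  · simp only [smul_mul_smul_comm, mul_add, add_mul, hTT, one_mul, mul_one]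
    module
  · rw [Unitary.mem_iff, hVstar]
    exact ⟨hVV', hVV⟩
  · rw [hVstar, mul_smul_comm, smul_mul_assoc, mul_add, add_mul, mul_one, hVV, hVT]
    module
  · simp [hφ1, hφT]
end

section
/- Let H be an infinite-dimensional complex Hilbert space and let φ : B(H) → ℂ be a state. Then {φ(P) : P ∈ B(H), P* = P = P²} is exactly the closed interval [0, 1]. -/
open ComplexOrder

namespace HilbertBasis

variable {ι H : Type*} [NormedAddCommGroup H] [InnerProductSpace ℂ H]

theorem continuousLinearMap_ext_s13 (b : HilbertBasis ι ℂ H) {A B : H →L[ℂ] H}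
    (h : ∀ i, A (b i) = B (b i)) : A = B := by
  refine ContinuousLinearMap.ext_on (s := Set.range b) ?_ ?_
  · exact Submodule.dense_iff_topologicalClosure_eq_top.mpr b.dense_span
  · rintro _ ⟨i, rfl⟩
    exact h i

variable [CompleteSpace H]

/-- The orthogonal projection onto the closed span of the basis vectors with index in `S`. -/
noncomputable def coordinateProjection (b : HilbertBasis ι ℂ H) (S : Set ι) : H →L[ℂ] H :=
  (Submodule.span ℂ (b '' S)).topologicalClosure.starProjection

theorem isStarProjection_coordinateProjection (b : HilbertBasis ι ℂ H) (S : Set ι) :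
    IsStarProjection (b.coordinateProjection S) :=
  isStarProjection_starProjection

theorem coordinateProjection_apply_of_mem (b : HilbertBasis ι ℂ H) {S : Set ι} {i : ι}
    (hi : i ∈ S) : b.coordinateProjection S (b i) = b i :=
  Submodule.starProjection_eq_self_iff.mpr <|
    Submodule.le_topologicalClosure _ <| Submodule.subset_span ⟨i, hi, rfl⟩

theorem coordinateProjection_apply_of_notMem (b : HilbertBasis ι ℂ H) {S : Set ι} {i : ι}
    (hi : i ∉ S) : b.coordinateProjection S (b i) = 0 := by
  refine Submodule.eq_starProjection_of_mem_orthogonal (Submodule.zero_mem _) ?_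
  rw [sub_zero, Submodule.orthogonal_closure]
  refine (Submodule.mem_orthogonal _ _).mpr fun u hu => ?_
  induction hu using Submodule.span_induction with
  | mem x hx =>
    obtain ⟨j, hj, rfl⟩ := hx
    exact b.orthonormal.2 fun h => hi (h ▸ hj)
  | zero => simp
  | add x y _ _ hx hy => rw [inner_add_left, hx, hy, add_zero]
  | smul c x _ hx => rw [inner_smul_left, hx, mul_zero]

theorem coordinateProjection_union (b : HilbertBasis ι ℂ H) {S T : Set ι} (h : Disjoint S T) :
    b.coordinateProjection (S ∪ T) = b.coordinateProjection S + b.coordinateProjection T := by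
  refine b.continuousLinearMap_ext_s13 fun i => ?_
  rw [add_apply]
  by_cases hS : i ∈ S
  · rw [b.coordinateProjection_apply_of_mem (Or.inl hS), b.coordinateProjection_apply_of_mem hS,
      b.coordinateProjection_apply_of_notMem (Set.disjoint_left.mp h hS), add_zero]
  · by_cases hT : i ∈ T
    · rw [b.coordinateProjection_apply_of_mem (Or.inr hT), b.coordinateProjection_apply_of_mem hT,
        b.coordinateProjection_apply_of_notMem hS, zero_add]
    · rw [b.coordinateProjection_apply_of_notMem (fun h => h.elim hS hT),
        b.coordinateProjection_apply_of_notMem hS, b.coordinateProjection_apply_of_notMem hT,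
        add_zero]

theorem exists_unitary_permuting (b : HilbertBasis ι ℂ H) (σ : Equiv.Perm ι) :
    ∃ U : H →L[ℂ] H, star U * U = 1 ∧ ∀ i, U (b i) = b (σ i) := by
  classical
  have hv : Orthonormal ℂ (b ∘ σ) := b.orthonormal.comp σ σ.injective
  have hsp : ⊤ ≤ (Submodule.span ℂ (Set.range (b ∘ σ))).topologicalClosure := by
    rw [σ.surjective.range_comp, b.dense_span]
  let b' := HilbertBasis.mk hv hsp
  let e : H ≃ₗᵢ[ℂ] H := b.repr.trans b'.repr.symm
  refine ⟨(e.toContinuousLinearEquiv : H →L[ℂ] H), ?_, fun i => ?_⟩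
  · exact (ContinuousLinearMap.norm_map_iff_adjoint_comp_self _).mp e.norm_map
  · change b'.repr.symm (b.repr (b i)) = _
    rw [b.repr_self, b'.repr_symm_single]
    exact congrFun (HilbertBasis.coe_mk hv hsp) i

/-- If a set of indices is equinumerous with its complement, a selfadjoint unitary exchanges the
corresponding coordinate projection with its complement. -/
theorem exists_symmetry_exchanging (b : HilbertBasis ι ℂ H) {S : Set ι}
    (f : S ≃ (Sᶜ : Set ι)) :
    ∃ U : H →L[ℂ] H, star U = U ∧ U * U = 1 ∧
      U * b.coordinateProjection S = (1 - b.coordinateProjection S) * U := by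
  classical
  let σ : Equiv.Perm ι := (Equiv.Set.sumCompl S).symm.trans
    (((Equiv.sumCongr f f.symm).trans (Equiv.sumComm _ _)).trans (Equiv.Set.sumCompl S))
  have hσS : ∀ i (hi : i ∈ S), σ i = f ⟨i, hi⟩ := fun i hi => by
    simp [σ, Equiv.Set.sumCompl_symm_apply_of_mem hi]
  have hσSc : ∀ i (hi : i ∉ S), σ i = f.symm ⟨i, hi⟩ := fun i hi => by
    simp [σ, Equiv.Set.sumCompl_symm_apply_of_notMem hi]
  have hmem : ∀ i, σ i ∈ S ↔ i ∉ S := fun i => by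
    by_cases hi : i ∈ S
    · rw [hσS i hi]
      exact iff_of_false (f ⟨i, hi⟩).2 (not_not.mpr hi)
    · rw [hσSc i hi]
      exact iff_of_true (f.symm ⟨i, hi⟩).2 hi
  have hσσ : ∀ i, σ (σ i) = i := fun i => by
    by_cases hi : i ∈ S
    · simp [hσS i hi, hσSc _ (f ⟨i, hi⟩).2]
    · simp [hσSc i hi, hσS _ (f.symm ⟨i, hi⟩).2]
  obtain ⟨U, hU, hUb⟩ := b.exists_unitary_permuting σ
  have hUU : U * U = 1 := b.continuousLinearMap_ext_s13 fun i => by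
    change U (U (b i)) = b i
    rw [hUb, hUb, hσσ]
  refine ⟨U, ?_, hUU, b.continuousLinearMap_ext_s13 fun i => ?_⟩
  · calc star U = star U * (U * U) := by rw [hUU, mul_one]
      _ = U := by rw [← mul_assoc, hU, one_mul]
  · change U (b.coordinateProjection S (b i)) = U (b i) - b.coordinateProjection S (U (b i))
    rw [hUb]
    by_cases hi : i ∈ S
    · rw [b.coordinateProjection_apply_of_mem hi, hUb,
        b.coordinateProjection_apply_of_notMem fun h => (hmem i).mp h hi, sub_zero]
    · rw [b.coordinateProjection_apply_of_notMem hi, map_zero,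
        b.coordinateProjection_apply_of_mem ((hmem i).mpr hi), sub_self]

end HilbertBasis

/-- The rotation path from a projection `P` to `1 - P` through a symmetry exchanging the two
consists of projections. -/
theorem IsStarProjection.rotation {A : Type*} [Ring A] [StarRing A] [Algebra ℂ A]
    [StarModule ℂ A] {P U : A} (hP : IsStarProjection P) (hU : star U = U) (hUU : U * U = 1)
    (hUP : U * P = (1 - P) * U) {c s : ℝ} (hcs : c ^ 2 + s ^ 2 = 1) :
    IsStarProjection
      (((c ^ 2 : ℝ) : ℂ) • P + ((c * s : ℝ) : ℂ) • U + ((s ^ 2 : ℝ) : ℂ) • (1 - P)) := by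
  have hPP : P * P = P := hP.isIdempotentElem
  have hPU : P * U = U - U * P := by rw [hUP]; noncomm_ring
  have hcs' : (c : ℂ) ^ 2 + (s : ℂ) ^ 2 = 1 := by exact_mod_cast hcs
  refine ⟨?_, ?_⟩
  · change _ * _ = _
    simp only [mul_add, add_mul, mul_sub, sub_mul, smul_mul_smul_comm, hPP, hPU, hUU, mul_one,
      one_mul]
    push_cast
    match_scalars <;> grind
  · simp [isSelfAdjoint_iff, hU, hP.isSelfAdjoint.star_eq]

/-- In an infinite type there are infinitely many pairwise disjoint subsets, each equinumerous
with its complement. -/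
theorem Infinite.exists_pairwise_disjoint_equiv_compl (ι : Type*) [Infinite ι] :
    ∃ S : ℕ → Set ι, Pairwise (Function.onFun Disjoint S) ∧
      ∀ n, Nonempty (S n ≃ ((S n)ᶜ : Set ι)) := by
  obtain ⟨e⟩ : Nonempty (ι × ℕ ≃ ι) := Cardinal.eq.mp (by simp)
  refine ⟨fun n => {i | (e.symm i).2 = n}, fun m n hmn => ?_, fun n => ?_⟩
  · exact Set.disjoint_left.mpr fun i hm hn => hmn (hm.symm.trans hn)
  · refine Function.Embedding.antisymm
      ⟨fun i => ⟨e (i, n + 1), by simp⟩, fun i j h => ?_⟩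
      ⟨fun i => ⟨e (i, n), by simp⟩, fun i j h => ?_⟩
    · simpa [Subtype.ext_iff] using h
    · simpa [Subtype.ext_iff] using h

theorem HilbertBasis.infinite_index {ι H : Type*} [NormedAddCommGroup H] [InnerProductSpace ℂ H]
    [CompleteSpace H] (b : HilbertBasis ι ℂ H) (hinf : ¬ FiniteDimensional ℂ H) : Infinite ι := by
  refine not_finite_iff_infinite.mp fun _ => hinf ?_
  have := Fintype.ofFinite ι
  exact b.toOrthonormalBasis.toBasis.finiteDimensional_of_finite

section State

variable {H : Type*} [NormedAddCommGroup H] [InnerProductSpace ℂ H] [CompleteSpace H]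
  {φ : (H →L[ℂ] H) →ₗ[ℂ] ℂ}

theorem state_apply_isStarProjection (hφ1 : φ 1 = 1)
    (hφpos : ∀ A : H →L[ℂ] H, A.IsPositive → 0 ≤ φ A) {P : H →L[ℂ] H}
    (hP : IsStarProjection P) :
    φ P = ((φ P).re : ℂ) ∧ 0 ≤ (φ P).re ∧ (φ P).re ≤ 1 := by
  have h0 := Complex.le_def.mp (hφpos P (.of_isStarProjection hP))
  have h1 := Complex.le_def.mp (hφpos (1 - P) (.of_isStarProjection hP.one_sub))
  simp only [map_sub, hφ1, Complex.zero_re, Complex.zero_im, Complex.sub_re, Complex.one_re]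
    at h0 h1
  exact ⟨Complex.ext rfl (by simpa using h0.2.symm), h0.1, by linarith [h1.1]⟩

theorem exists_small_state_value (hφ1 : φ 1 = 1)
    (hφpos : ∀ A : H →L[ℂ] H, A.IsPositive → 0 ≤ φ A) {ι : Type*} (b : HilbertBasis ι ℂ H)
    {S : ℕ → Set ι} (hS : Pairwise (Function.onFun Disjoint S)) {ε : ℝ} (hε : 0 < ε) :
    ∃ n, (φ (b.coordinateProjection (S n))).re < ε := by
  by_contra! h
  have key : ∀ N : ℕ, N * ε ≤ (φ (b.coordinateProjection (⋃ n < N, S n))).re := fun N => by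
    induction N with
    | zero =>
      simpa using (state_apply_isStarProjection hφ1 hφpos
        (b.isStarProjection_coordinateProjection _)).2.1
    | succ N ih =>
      have hdisj : Disjoint (⋃ n < N, S n) (S N) := by
        simp only [Set.disjoint_iUnion_left]
        exact fun n hn => hS hn.ne
      rw [Set.biUnion_lt_succ, b.coordinateProjection_union hdisj, map_add, Complex.add_re]
      push_cast
      linarith [h N]
  obtain ⟨N, hN⟩ := exists_nat_gt (1 / ε)
  rw [div_lt_iff₀ hε] at hN
  linarith [key N, (state_apply_isStarProjection hφ1 hφpos
    (b.isStarProjection_coordinateProjection (⋃ n < N, S n))).2.2]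

theorem exists_isStarProjection_state_eq (hφ1 : φ 1 = 1)
    (hφpos : ∀ A : H →L[ℂ] H, A.IsPositive → 0 ≤ φ A) {P U : H →L[ℂ] H}
    (hP : IsStarProjection P) (hU : star U = U) (hUU : U * U = 1)
    (hUP : U * P = (1 - P) * U) {t : ℝ} (ht0 : (φ P).re ≤ t) (ht1 : t ≤ 1 - (φ P).re) :
    ∃ Q : H →L[ℂ] H, IsStarProjection Q ∧ φ Q = t := by
  let g : ℝ → ℝ := fun x => Real.cos x ^ 2 * (φ P).re + Real.cos x * Real.sin x * (φ U).re
    + Real.sin x ^ 2 * (1 - (φ P).re)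
  have hg : ContinuousOn g (Set.Icc 0 (Real.pi / 2)) := by fun_prop
  obtain ⟨x, -, hx⟩ := intermediate_value_Icc (by positivity) hg
    (show t ∈ Set.Icc (g 0) (g (Real.pi / 2)) by simpa [g] using ⟨ht0, ht1⟩)
  have hQ := hP.rotation hU hUU hUP (Real.cos_sq_add_sin_sq x)
  refine ⟨_, hQ, ?_⟩
  rw [(state_apply_isStarProjection hφ1 hφpos hQ).1, ← hx]
  congr 1
  simp only [map_add, map_sub, map_smul, hφ1, smul_eq_mul, Complex.add_re, Complex.re_ofReal_mul,
    Complex.sub_re, Complex.one_re, g]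

end State

/-- For any state `φ` on `B(H)`, `H` an infinite-dimensional complex Hilbert
space, the set of values of `φ` on orthogonal projections is exactly `[0, 1]`. -/
theorem state_image_projections_eq_Icc
    {H : Type*} [NormedAddCommGroup H] [InnerProductSpace ℂ H] [CompleteSpace H]
    (hinf : ¬ FiniteDimensional ℂ H)
    (φ : (H →L[ℂ] H) →ₗ[ℂ] ℂ) (hφ1 : φ 1 = 1)
    (hφpos : ∀ A : H →L[ℂ] H, A.IsPositive → 0 ≤ φ A) :
    {z : ℂ | ∃ P : H →L[ℂ] H, star P = P ∧ P * P = P ∧ φ P = z}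
      = (fun t : ℝ => (t : ℂ)) '' Set.Icc (0 : ℝ) 1 := by
  ext z
  constructor
  · rintro ⟨P, hPstar, hPP, rfl⟩
    have hP := state_apply_isStarProjection hφ1 hφpos (P := P) ⟨hPP, hPstar⟩
    exact ⟨(φ P).re, hP.2, hP.1.symm⟩
  · rintro ⟨t, ⟨ht0, ht1⟩, rfl⟩
    suffices ∃ Q : H →L[ℂ] H, IsStarProjection Q ∧ φ Q = t by
      obtain ⟨Q, hQ, hQt⟩ := this
      exact ⟨Q, hQ.isSelfAdjoint, hQ.isIdempotentElem, hQt⟩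
    rcases ht0.eq_or_lt with rfl | ht0
    · exact ⟨0, .zero _, by simp⟩
    rcases ht1.eq_or_lt with rfl | ht1
    · exact ⟨1, .one _, by simp [hφ1]⟩
    obtain ⟨w, b, -⟩ := exists_hilbertBasis ℂ H
    have := b.infinite_index hinf
    obtain ⟨S, hS, hSc⟩ := Infinite.exists_pairwise_disjoint_equiv_compl w
    obtain ⟨n, hn⟩ := exists_small_state_value hφ1 hφpos b hS (lt_min ht0 (sub_pos.mpr ht1))
    obtain ⟨f⟩ := hSc n
    obtain ⟨U, hU, hUU, hUP⟩ := b.exists_symmetry_exchanging f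
    have := lt_min_iff.mp hn
    exact exists_isStarProjection_state_eq hφ1 hφpos (b.isStarProjection_coordinateProjection _)
      hU hUU hUP this.1.le (by linarith [this.2])
end

section
/- Let H be a complex Hilbert space, let φ : B(H) → ℂ be a state, and let P, Q be orthogonal projections on H that are unitarily equivalent (Q = V P V* for some unitary V). Then for every real number t between φ(P) and φ(Q), there exists a unitary U on H such that φ(U P U*) = t. -/
open ComplexOrder

namespace ContinuousLinearMap

variable {H : Type*} [NormedAddCommGroup H] [InnerProductSpace ℂ H] [CompleteSpace H]

theorem mul_starProjection_ker_self (B : H →L[ℂ] H) : B * B.ker.starProjection = 0 := by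
  ext x
  exact LinearMap.mem_ker.mp (Submodule.starProjection_apply_mem B.ker x)

theorem starProjection_ker_mul_of_mul_eq_zero {A B : H →L[ℂ] H} (h : B * A = 0) :
    B.ker.starProjection * A = A := by
  ext x
  exact Submodule.starProjection_eq_self_iff.mpr
    (LinearMap.mem_ker.mpr (by simpa using congr($h x)))

/-- The projection onto the kernel of `B` commutes with every operator `T` such that `B` commutes
with both `T` and `T*`. -/
theorem commute_starProjection_ker {T B : H →L[ℂ] H} (h : Commute B T) (h' : Commute B (star T)) :
    Commute B.ker.starProjection T := by
  have key {T : H →L[ℂ] H} (h : Commute B T) :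
      B.ker.starProjection * (T * B.ker.starProjection) = T * B.ker.starProjection := by
    apply starProjection_ker_mul_of_mul_eq_zero
    rw [← mul_assoc, h.eq, mul_assoc, mul_starProjection_ker_self, mul_zero]
  have hE : star B.ker.starProjection = B.ker.starProjection :=
    isSelfAdjoint_starProjection B.ker
  have h2 := congr(star $(key h'))
  simp only [star_mul, star_star, hE] at h2
  exact h2.symm.trans ((mul_assoc _ _ _).trans (key h))

/-- A self-adjoint operator `S` is the product of its absolute value and a self-adjoint unitary
commuting with every operator `T` such that `S` commutes with both `T` and `T*`. -/
theorem exists_symmetry_mul_eq_posPart_add_negPart {S : H →L[ℂ] H} (hS : IsSelfAdjoint S) :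
    ∃ J : H →L[ℂ] H, IsSelfAdjoint J ∧ J * J = 1 ∧ J * S = S⁺ + S⁻ ∧
      ∀ T, Commute S T → Commute S (star T) → Commute J T := by
  obtain ⟨E, hEdef⟩ : ∃ E, E = S⁺.ker.starProjection := ⟨_, rfl⟩
  have hE : IsSelfAdjoint E := hEdef ▸ isSelfAdjoint_starProjection S⁺.ker
  have hEE : E * E = E := hEdef ▸ S⁺.ker.isIdempotentElem_starProjection
  have hpos : E * S⁺ = 0 := by
    have h := congr(star $(mul_starProjection_ker_self S⁺))
    rwa [star_mul, star_zero, ← hEdef, hE.star_eq,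
      (IsSelfAdjoint.of_nonneg (CFC.posPart_nonneg S)).star_eq] at h
  have hneg : E * S⁻ = S⁻ := hEdef ▸
    starProjection_ker_mul_of_mul_eq_zero (CFC.posPart_mul_negPart S)
  refine ⟨1 - (E + E), (IsSelfAdjoint.one _).sub (hE.add hE), ?_, ?_, ?_⟩
  · simp only [sub_mul, mul_sub, one_mul, mul_one, add_mul, mul_add, hEE]
    abel
  · nth_rewrite 1 [← CFC.posPart_sub_negPart S hS]
    simp only [sub_mul, mul_sub, one_mul, add_mul, hpos, hneg]
    abel
  · intro T h h'
    have hc : Commute E T := hEdef ▸ commute_starProjection_ker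
      (hS.commute_cfcₙ h _) (hS.commute_cfcₙ h' _)
    exact (Commute.one_left T).sub_left (hc.add_left hc)

/-- The unitary group of `B(H)` is path-connected. -/
theorem joined_one_unitary (V : unitary (H →L[ℂ] H)) : Joined 1 V := by
  obtain ⟨J, hJ, hJJ, hJS, hJc⟩ :=
    exists_symmetry_mul_eq_posPart_add_negPart (imaginaryPart (V : H →L[ℂ] H)).2
  set S : H →L[ℂ] H := (imaginaryPart (V : H →L[ℂ] H) : H →L[ℂ] H) with hSdef
  have hV : star (V : H →L[ℂ] H) * V = 1 := Unitary.coe_star_mul_self V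
  have hV' : (V : H →L[ℂ] H) * star (V : H →L[ℂ] H) = 1 := Unitary.coe_mul_star_self V
  have hdiff : star (V : H →L[ℂ] H) - V = -(2 * Complex.I) • S := by
    rw [hSdef, imaginaryPart_apply_coe]
    simp only [← Complex.coe_smul, smul_smul]
    rw [show -(2 * Complex.I) * (-Complex.I * ((2⁻¹ : ℝ) : ℂ)) = -1 by
      push_cast; linear_combination Complex.I_mul_I]
    simp
  have hS : S = (Complex.I / 2) • (star (V : H →L[ℂ] H) - V) := by
    rw [hdiff, smul_smul, show Complex.I / 2 * -(2 * Complex.I) = 1 by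
      linear_combination -Complex.I_mul_I, one_smul]
  have hVV : Commute (V : H →L[ℂ] H) (star (V : H →L[ℂ] H)) := hV'.trans hV.symm
  have hSV : Commute S V := by
    rw [hS]; exact (hVV.symm.sub_left (Commute.refl _)).smul_left _
  have hSV' : Commute S (star (V : H →L[ℂ] H)) := by
    rw [hS]; exact ((Commute.refl _).sub_left hVV).smul_left _
  have hJV' : Commute J (star (V : H →L[ℂ] H)) := hJc _ hSV' (by rwa [star_star])
  have hsW : star (Complex.I • J) = -(Complex.I • J) := by
    simp [star_smul, hJ.star_eq]
  have hWW : (Complex.I • J) * (Complex.I • J) = -1 := by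
    simp [smul_smul, hJJ]
  let W : unitary (H →L[ℂ] H) := ⟨Complex.I • J, by
    rw [Unitary.mem_iff, hsW, neg_mul, mul_neg, hWW]; simp⟩
  have norm_lt {A : H →L[ℂ] H} (h : star A * A ≤ 2) : ‖A‖ < 2 := by
    have h1 := CStarAlgebra.norm_le_norm_of_nonneg_of_le (star_mul_self_nonneg A) h
    have h2 : ‖(2 : H →L[ℂ] H)‖ ≤ 2 := by
      rw [show (2 : H →L[ℂ] H) = (2 : ℝ) • 1 by rw [two_smul, one_add_one_eq_two]]
      simpa using (norm_smul_le (2 : ℝ) (1 : H →L[ℂ] H)).trans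
        (mul_le_mul_of_nonneg_left ContinuousLinearMap.norm_id_le (norm_nonneg _))
    rw [CStarRing.norm_star_mul_self] at h1
    nlinarith [norm_nonneg A]
  have h1W : Joined 1 W := by
    apply Unitary.joined
    apply norm_lt
    apply le_of_eq
    change star (Complex.I • J - 1) * (Complex.I • J - 1) = 2
    rw [star_sub, star_one, hsW]
    rw [sub_mul, mul_sub, neg_mul, hWW, one_mul, mul_one, ← one_add_one_eq_two]
    abel
  have hWV : Joined W V := by
    apply Unitary.joined
    apply norm_lt
    change star ((V : H →L[ℂ] H) - Complex.I • J) * (V - Complex.I • J) ≤ 2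
    have hcross : star (V : H →L[ℂ] H) * (Complex.I • J) - (Complex.I • J) * V
        = (2 : ℂ) • (S⁺ + S⁻) := by
      rw [mul_smul_comm, ← hJV'.eq, smul_mul_assoc, ← smul_sub, ← mul_sub, hdiff, mul_smul_comm,
        hJS, smul_smul]
      congr 1
      linear_combination -2 * Complex.I_mul_I
    have hexp : star ((V : H →L[ℂ] H) - Complex.I • J) * (V - Complex.I • J)
        = 2 - ((S⁺ + S⁻) + (S⁺ + S⁻)) := by
      rw [← two_smul ℂ (S⁺ + S⁻), ← hcross, star_sub, hsW, sub_neg_eq_add, add_mul, mul_sub,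
        mul_sub, hV, hWW, ← one_add_one_eq_two]
      abel
    rw [hexp]
    have h := add_nonneg (CFC.posPart_nonneg S) (CFC.negPart_nonneg S)
    exact sub_le_self _ (add_nonneg h h)
  exact h1W.trans hWV

end ContinuousLinearMap

/-- Intermediate value property along the unitary orbit of a projection: if
`P` and `Q` are unitarily equivalent orthogonal projections on a complex
Hilbert space and `φ` is a state on `B(H)`, then every real `t` between
`φ(P)` and `φ(Q)` is attained as `φ(U P U*)` for some unitary `U`. -/
theorem state_intermediate_value_on_unitary_orbit
    {H : Type*} [NormedAddCommGroup H] [InnerProductSpace ℂ H] [CompleteSpace H]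
    (φ : (H →L[ℂ] H) →ₗ[ℂ] ℂ) (hφ1 : φ 1 = 1)
    (hφpos : ∀ A : H →L[ℂ] H, A.IsPositive → 0 ≤ φ A)
    (P Q : H →L[ℂ] H) (hP : star P = P ∧ P * P = P) (hQ : star Q = Q ∧ Q * Q = Q)
    (hPQ : ∃ V ∈ unitary (H →L[ℂ] H), Q = V * P * star V)
    (t : ℝ) (ht : t ∈ Set.uIcc (φ P).re (φ Q).re) :
    ∃ U ∈ unitary (H →L[ℂ] H), φ (U * P * star U) = (t : ℂ) := by
  obtain ⟨V, hV, rfl⟩ := hPQ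
  let ψ : (H →L[ℂ] H) →ₚ[ℂ] ℂ := PositiveLinearMap.mk₀ φ fun A hA =>
    hφpos A ((ContinuousLinearMap.nonneg_iff_isPositive A).mp hA)
  have hφ : Continuous φ := map_continuous ψ
  obtain ⟨γ⟩ := ContinuousLinearMap.joined_one_unitary (⟨V, hV⟩ : unitary (H →L[ℂ] H))
  have hγ : Continuous fun s => (γ s : H →L[ℂ] H) := continuous_subtype_val.comp γ.continuous
  have hf : Continuous fun s => (φ ((γ s : H →L[ℂ] H) * P * star (γ s : H →L[ℂ] H))).re :=
    Complex.continuous_re.comp (hφ.comp ((hγ.mul continuous_const).mul hγ.star))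
  obtain ⟨s, hs⟩ := mem_range_of_exists_le_of_exists_ge hf
    (c := t) (by
      rcases Set.mem_uIcc.mp ht with h | h
      · exact ⟨0, by simpa using h.1⟩
      · exact ⟨1, by simpa using h.1⟩) (by
      rcases Set.mem_uIcc.mp ht with h | h
      · exact ⟨1, by simpa using h.2⟩
      · exact ⟨0, by simpa using h.2⟩)
  refine ⟨γ s, (γ s).2, Complex.ext hs ?_⟩
  have hP0 : 0 ≤ P := by
    rw [← hP.2]
    nth_rewrite 1 [← hP.1]
    exact star_mul_self_nonneg P
  have h := hφpos _ ((ContinuousLinearMap.nonneg_iff_isPositive _).mp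
    (star_right_conjugate_nonneg hP0 (γ s : H →L[ℂ] H)))
  simpa using (Complex.nonneg_iff.mp h).2.symm
end
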